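/- arXiv:1906.07120 — 3 statements merged into one kernel-verified Lean document; each statement's English description precedes it below -/
import Mathlib

section
/- Let μ, μ̃ ∈ P(E) and let Φ : E → [0, ∞) be measurable. Then the posterior measures μ_Φ(dx) := Z^{−1} exp(−Φ(x)) μ(dx) and μ̃_Φ(dx) := Z̃^{−1} exp(−Φ(x)) μ̃(dx), with Z := ∫_E exp(−Φ) dμ and Z̃ := ∫_E exp(−Φ) dμ̃, satisfy d_TV(μ_Φ, μ̃_Φ) ≤ (2 / Z) · d_TV(μ, μ̃). -/
open MeasureTheory Real

/-- The posterior measure `μ_Φ(dx) = Z⁻¹ exp(-Φ(x)) μ(dx)`. -/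
noncomputable def posterior {E : Type*} [MeasurableSpace E] (μ : Measure E) (Φ : E → ℝ) :
    Measure E :=
  (∫⁻ x, ENNReal.ofReal (Real.exp (-Φ x)) ∂μ)⁻¹ •
    μ.withDensity (fun x => ENNReal.ofReal (Real.exp (-Φ x)))

/-- The total variation distance `d_TV(μ, ν) = sup_A |μ(A) - ν(A)|` over measurable sets. -/
noncomputable def tvDist {E : Type*} [MeasurableSpace E] (μ ν : Measure E) : ℝ :=
  ⨆ A : {s : Set E // MeasurableSet s}, |(μ A).toReal - (ν A).toReal|

lemma abs_measureReal_sub_le_tvDist {E : Type*} [MeasurableSpace E] (μ ν : Measure E)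
    [IsFiniteMeasure μ] [IsFiniteMeasure ν] {A : Set E} (hA : MeasurableSet A) :
    |μ.real A - ν.real A| ≤ tvDist μ ν := by
  refine le_ciSup (f := fun A : {s : Set E // MeasurableSet s} =>
    |(μ A).toReal - (ν A).toReal|) ⟨μ.real Set.univ + ν.real Set.univ, ?_⟩ ⟨A, hA⟩
  rintro _ ⟨B, rfl⟩
  refine (abs_sub _ _).trans ?_
  rw [abs_of_nonneg ENNReal.toReal_nonneg, abs_of_nonneg ENNReal.toReal_nonneg]
  exact add_le_add (measureReal_mono (Set.subset_univ _)) (measureReal_mono (Set.subset_univ _))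

lemma integrableOn_measureReal_superlevel {E : Type*} [MeasurableSpace E] (μ : Measure E)
    [IsFiniteMeasure μ] (f : E → ℝ) :
    IntegrableOn (fun t => μ.real {x | t ≤ f x}) (Set.Ioc 0 1) := by
  have hanti : Antitone fun t => μ.real {x | t ≤ f x} := fun s t hst =>
    measureReal_mono fun x (hx : t ≤ f x) => hst.trans hx
  refine Integrable.of_bound hanti.measurable.aestronglyMeasurable (μ.real Set.univ)
    (ae_of_all _ fun t => ?_)
  rw [Real.norm_of_nonneg measureReal_nonneg]
  exact measureReal_mono (Set.subset_univ _)

/-- Integrals of a `[0, 1]`-valued measurable function differ by at most the total variation. -/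
lemma abs_integral_sub_le_tvDist {E : Type*} [MeasurableSpace E] (μ ν : Measure E)
    [IsFiniteMeasure μ] [IsFiniteMeasure ν] {f : E → ℝ} (hf : Measurable f)
    (hf0 : ∀ x, 0 ≤ f x) (hf1 : ∀ x, f x ≤ 1) :
    |∫ x, f x ∂μ - ∫ x, f x ∂ν| ≤ tvDist μ ν := by
  have layercake (ρ : Measure E) [IsFiniteMeasure ρ] :
      ∫ x, f x ∂ρ = ∫ t in Set.Ioc 0 1, ρ.real {x | t ≤ f x} := by
    refine Integrable.integral_eq_integral_Ioc_meas_le ?_ (ae_of_all _ hf0) (ae_of_all _ hf1)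
    refine Integrable.of_bound hf.aestronglyMeasurable 1 (ae_of_all _ fun x => ?_)
    rw [Real.norm_of_nonneg (hf0 x)]
    exact hf1 x
  rw [layercake μ, layercake ν, ← integral_sub (integrableOn_measureReal_superlevel μ f)
    (integrableOn_measureReal_superlevel ν f), ← Real.norm_eq_abs]
  refine (norm_setIntegral_le_of_norm_le_const (C := tvDist μ ν) (by simp) fun t _ => ?_).trans
    (by simp)
  exact abs_measureReal_sub_le_tvDist μ ν (measurableSet_le measurable_const hf)

lemma integrable_exp_neg {E : Type*} [MeasurableSpace E] (μ : Measure E) [IsFiniteMeasure μ]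
    {Φ : E → ℝ} (hΦ : Measurable Φ) (hΦ0 : ∀ x, 0 ≤ Φ x) :
    Integrable (fun x => Real.exp (-Φ x)) μ := by
  refine Integrable.of_bound hΦ.neg.exp.aestronglyMeasurable 1 (ae_of_all _ fun x => ?_)
  rw [Real.norm_of_nonneg (Real.exp_pos _).le]
  exact Real.exp_le_one_iff.2 (neg_nonpos.2 (hΦ0 x))

lemma posterior_apply_toReal {E : Type*} [MeasurableSpace E] (μ : Measure E)
    {Φ : E → ℝ} (hΦ : Measurable Φ) {A : Set E} (hA : MeasurableSet A) :
    (posterior μ Φ A).toReal =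
      (∫ x in A, Real.exp (-Φ x) ∂μ) / ∫ x, Real.exp (-Φ x) ∂μ := by
  have toReal_lintegral (ρ : Measure E) :
      (∫⁻ x, ENNReal.ofReal (Real.exp (-Φ x)) ∂ρ).toReal = ∫ x, Real.exp (-Φ x) ∂ρ :=
    (integral_eq_lintegral_of_nonneg_ae (ae_of_all _ fun x => (Real.exp_pos _).le)
      hΦ.neg.exp.aestronglyMeasurable).symm
  rw [posterior, Measure.smul_apply, withDensity_apply _ hA, smul_eq_mul, ENNReal.toReal_mul,
    ENNReal.toReal_inv, toReal_lintegral, toReal_lintegral, div_eq_inv_mul]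

theorem tv_stability_prior
    {E : Type*} [MetricSpace E] [CompleteSpace E] [TopologicalSpace.SeparableSpace E]
    [MeasurableSpace E] [BorelSpace E]
    (μ μt : Measure E) [IsProbabilityMeasure μ] [IsProbabilityMeasure μt]
    (Φ : E → ℝ) (hΦmeas : Measurable Φ) (hΦpos : ∀ x, 0 ≤ Φ x) :
    tvDist (posterior μ Φ) (posterior μt Φ) ≤
      2 / (∫ x, Real.exp (-Φ x) ∂μ) * tvDist μ μt := by
  have hexp1 (x : E) : Real.exp (-Φ x) ≤ 1 := Real.exp_le_one_iff.2 (neg_nonpos.2 (hΦpos x))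
  have hint := integrable_exp_neg μt hΦmeas hΦpos
  have hZ : 0 < ∫ x, Real.exp (-Φ x) ∂μ := integral_exp_pos (integrable_exp_neg μ hΦmeas hΦpos)
  have hZt : 0 < ∫ x, Real.exp (-Φ x) ∂μt := integral_exp_pos hint
  have hZdiff := abs_integral_sub_le_tvDist μ μt hΦmeas.neg.exp (fun x => (Real.exp_pos _).le) hexp1
  have : Nonempty {s : Set E // MeasurableSet s} := ⟨⟨∅, MeasurableSet.empty⟩⟩
  refine ciSup_le fun ⟨A, hA⟩ => ?_
  rw [posterior_apply_toReal μ hΦmeas hA, posterior_apply_toReal μt hΦmeas hA]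
  have hAdiff := abs_integral_sub_le_tvDist μ μt (hΦmeas.neg.exp.indicator hA)
    (Set.indicator_nonneg fun x _ => (Real.exp_pos _).le)
    (fun x => (Set.indicator_le_self' (fun _ _ => (Real.exp_pos _).le) x).trans (hexp1 x))
  rw [integral_indicator hA, integral_indicator hA] at hAdiff
  have ha0 : 0 ≤ ∫ x in A, Real.exp (-Φ x) ∂μt := integral_nonneg fun x => (Real.exp_pos _).le
  have haZ : ∫ x in A, Real.exp (-Φ x) ∂μt ≤ ∫ x, Real.exp (-Φ x) ∂μt :=
    setIntegral_le_integral hint (ae_of_all _ fun x => (Real.exp_pos _).le)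
  simp only [Pi.neg_apply] at hZdiff hAdiff
  generalize (∫ x, Real.exp (-Φ x) ∂μ) = Z at *
  generalize (∫ x, Real.exp (-Φ x) ∂μt) = Zt at *
  generalize (∫ x in A, Real.exp (-Φ x) ∂μ) = a at *
  generalize (∫ x in A, Real.exp (-Φ x) ∂μt) = b at *
  have hsplit : a / Z - b / Zt = ((a - b) - b / Zt * (Z - Zt)) / Z := by
    field_simp
    ring
  have hratio : |b / Zt * (Z - Zt)| ≤ tvDist μ μt := by
    rw [abs_mul, abs_of_nonneg (div_nonneg ha0 hZt.le)]
    exact (mul_le_of_le_one_left (abs_nonneg _) ((div_le_one hZt).2 haZ)).trans hZdiff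
  rw [hsplit, abs_div, abs_of_pos hZ, div_mul_eq_mul_div 2]
  gcongr
  linarith [abs_sub (a - b) (b / Zt * (Z - Zt))]
end

section
/- Let μ, μ̃ ∈ P(E) be equivalent (i.e., mutually absolutely continuous) and let Φ : E → [0, ∞) be measurable. Then the posterior measures μ_Φ(dx) := Z^{−1} exp(−Φ(x)) μ(dx) and μ̃_Φ(dx) := Z̃^{−1} exp(−Φ(x)) μ̃(dx), with Z := ∫_E exp(−Φ) dμ and Z̃ := ∫_E exp(−Φ) dμ̃, satisfy d_KL(μ_Φ ‖ μ̃_Φ) ≤ (1 / min(Z, Z̃)) · (d_KL(μ ‖ μ̃) + d_KL(μ̃ ‖ μ)). -/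
open MeasureTheory Real ENNReal

open Classical in
/-- The Kullback–Leibler divergence `d_KL(μ‖ν) = ∫ log(dμ/dν) dμ` if `μ ≪ ν` (and the
integral exists), and `+∞` otherwise. -/
noncomputable def klDiv {E : Type*} [MeasurableSpace E] (μ ν : Measure E) : ℝ≥0∞ :=
  if μ ≪ ν ∧ Integrable (fun x => Real.log ((μ.rnDeriv ν x).toReal)) μ then
    ENNReal.ofReal (∫ x, Real.log ((μ.rnDeriv ν x).toReal) ∂μ)
  else ⊤

section Posterior

variable {E : Type*} [MeasurableSpace E] {μ ν : Measure E} {Φ : E → ℝ}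

lemma integrable_exp_neg_of_nonneg [IsFiniteMeasure μ] (hΦ : Measurable Φ) (hΦ0 : ∀ x, 0 ≤ Φ x) :
    Integrable (fun x => Real.exp (-Φ x)) μ := by
  refine Integrable.of_bound (C := 1) (by fun_prop) (.of_forall fun x => ?_)
  rw [Real.norm_eq_abs, Real.abs_exp]
  exact Real.exp_le_one_iff.mpr (neg_nonpos.mpr (hΦ0 x))

lemma posterior_eq_smul_withDensity (hint : Integrable (fun x => Real.exp (-Φ x)) μ) :
    posterior μ Φ = (ENNReal.ofReal (∫ x, Real.exp (-Φ x) ∂μ))⁻¹ •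
      μ.withDensity (fun x => ENNReal.ofReal (Real.exp (-Φ x))) := by
  rw [posterior, ofReal_integral_eq_lintegral_ofReal hint (.of_forall fun x => (Real.exp_pos _).le)]

lemma isProbabilityMeasure_posterior [NeZero μ] (hint : Integrable (fun x => Real.exp (-Φ x)) μ) :
    IsProbabilityMeasure (posterior μ Φ) := by
  constructor
  rw [posterior_eq_smul_withDensity hint, Measure.smul_apply, withDensity_apply _ .univ,
    Measure.restrict_univ,
    ← ofReal_integral_eq_lintegral_ofReal hint (.of_forall fun x => (Real.exp_pos _).le)]
  exact ENNReal.inv_mul_cancel (ENNReal.ofReal_pos.mpr (integral_exp_pos hint)).ne'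
    ENNReal.ofReal_ne_top

lemma posterior_absolutelyContinuous : posterior μ Φ ≪ μ :=
  Measure.smul_absolutelyContinuous.trans (withDensity_absolutelyContinuous _ _)

lemma integral_posterior (hΦ : Measurable Φ) (hint : Integrable (fun x => Real.exp (-Φ x)) μ)
    (f : E → ℝ) :
    ∫ x, f x ∂(posterior μ Φ) =
      (∫ x, Real.exp (-Φ x) ∂μ)⁻¹ * ∫ x, Real.exp (-Φ x) * f x ∂μ := by
  have hZ : 0 ≤ ∫ x, Real.exp (-Φ x) ∂μ := integral_nonneg fun x => (Real.exp_pos _).le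
  rw [posterior_eq_smul_withDensity hint, integral_smul_measure,
    integral_withDensity_eq_integral_toReal_smul (by fun_prop)
      (.of_forall fun _ => ENNReal.ofReal_lt_top)]
  simp [ENNReal.toReal_inv, ENNReal.toReal_ofReal, hZ, (Real.exp_pos _).le]

lemma Integrable.exp_neg_mul {f : E → ℝ} (hf : Integrable f μ) (hΦ : Measurable Φ)
    (hΦ0 : ∀ x, 0 ≤ Φ x) : Integrable (fun x => Real.exp (-Φ x) * f x) μ := by
  refine hf.bdd_mul (c := 1) (by fun_prop) (.of_forall fun x => ?_)
  rw [Real.norm_eq_abs, Real.abs_exp]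
  exact Real.exp_le_one_iff.mpr (neg_nonpos.mpr (hΦ0 x))

lemma Integrable.posterior [IsFiniteMeasure μ] [NeZero μ] {f : E → ℝ} (hf : Integrable f μ)
    (hΦ : Measurable Φ) (hΦ0 : ∀ x, 0 ≤ Φ x) : Integrable f (posterior μ Φ) := by
  have hint := integrable_exp_neg_of_nonneg (μ := μ) hΦ hΦ0
  rw [posterior_eq_smul_withDensity hint]
  refine Integrable.smul_measure ?_
    (ENNReal.inv_ne_top.mpr (ENNReal.ofReal_pos.mpr (integral_exp_pos hint)).ne')
  rw [integrable_withDensity_iff_integrable_smul' (by fun_prop)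
    (.of_forall fun _ => ENNReal.ofReal_lt_top)]
  simpa [ENNReal.toReal_ofReal, (Real.exp_pos _).le] using Integrable.exp_neg_mul hf hΦ hΦ0

lemma posterior_eq_withDensity_posterior [SigmaFinite μ] [SigmaFinite ν] [NeZero ν]
    (hμν : μ ≪ ν) (hΦ : Measurable Φ)
    (hμ : Integrable (fun x => Real.exp (-Φ x)) μ) (hν : Integrable (fun x => Real.exp (-Φ x)) ν) :
    posterior μ Φ = (posterior ν Φ).withDensity
      (((ENNReal.ofReal (∫ x, Real.exp (-Φ x) ∂μ))⁻¹ * ENNReal.ofReal (∫ x, Real.exp (-Φ x) ∂ν)) •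
        μ.rnDeriv ν) := by
  have hg : Measurable fun x => ENNReal.ofReal (Real.exp (-Φ x)) := by fun_prop
  have hr := Measure.measurable_rnDeriv μ ν
  rw [withDensity_smul _ hr, posterior_eq_smul_withDensity hν, withDensity_smul_measure,
    ← withDensity_mul _ hg hr, mul_comm _ (μ.rnDeriv ν), withDensity_mul _ hr hg,
    Measure.withDensity_rnDeriv_eq _ _ hμν, posterior_eq_smul_withDensity hμ, smul_smul, mul_assoc,
    ENNReal.mul_inv_cancel (ENNReal.ofReal_pos.mpr (integral_exp_pos hν)).ne'
      ENNReal.ofReal_ne_top, mul_one]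

lemma posterior_absolutelyContinuous_posterior [SigmaFinite μ] [SigmaFinite ν] [NeZero ν]
    (hμν : μ ≪ ν) (hΦ : Measurable Φ)
    (hμ : Integrable (fun x => Real.exp (-Φ x)) μ) (hν : Integrable (fun x => Real.exp (-Φ x)) ν) :
    posterior μ Φ ≪ posterior ν Φ := by
  rw [posterior_eq_withDensity_posterior hμν hΦ hμ hν]
  exact withDensity_absolutelyContinuous _ _

lemma llr_posterior [SigmaFinite μ] [SigmaFinite ν] [NeZero μ] [NeZero ν]
    (hμν : μ ≪ ν) (hΦ : Measurable Φ)
    (hμ : Integrable (fun x => Real.exp (-Φ x)) μ) (hν : Integrable (fun x => Real.exp (-Φ x)) ν) :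
    llr (posterior μ Φ) (posterior ν Φ) =ᵐ[posterior μ Φ] fun x =>
      llr μ ν x + Real.log ((∫ x, Real.exp (-Φ x) ∂ν) / ∫ x, Real.exp (-Φ x) ∂μ) := by
  have := isProbabilityMeasure_posterior hν
  have hZμ := integral_exp_pos hμ
  have hZν := integral_exp_pos hν
  have hderiv := Measure.rnDeriv_withDensity (posterior ν Φ)
    ((Measure.measurable_rnDeriv μ ν).const_smul
      ((ENNReal.ofReal (∫ x, Real.exp (-Φ x) ∂μ))⁻¹ * ENNReal.ofReal (∫ x, Real.exp (-Φ x) ∂ν)))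
  rw [← posterior_eq_withDensity_posterior hμν hΦ hμ hν] at hderiv
  filter_upwards [(posterior_absolutelyContinuous_posterior hμν hΦ hμ hν).ae_le hderiv,
    posterior_absolutelyContinuous.ae_le (Measure.rnDeriv_pos hμν),
    posterior_absolutelyContinuous.ae_le (hμν.ae_le (Measure.rnDeriv_lt_top μ ν))]
    with x hx hpos hlt
  have hr : (μ.rnDeriv ν x).toReal ≠ 0 := (ENNReal.toReal_pos hpos.ne' hlt.ne).ne'
  rw [llr, llr, hx, Pi.smul_apply, smul_eq_mul, ENNReal.toReal_mul, ENNReal.toReal_mul,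
    ENNReal.toReal_inv, ENNReal.toReal_ofReal hZμ.le, ENNReal.toReal_ofReal hZν.le,
    Real.log_mul (by positivity) hr, add_comm, inv_mul_eq_div]

/-- The log-likelihood ratio of two posteriors has expectation at most `Z⁻¹` times the
Kullback–Leibler divergence of the priors. -/
lemma integral_llr_posterior_le [IsProbabilityMeasure μ] [IsProbabilityMeasure ν]
    (hμν : μ ≪ ν) (hΦ : Measurable Φ) (hΦ0 : ∀ x, 0 ≤ Φ x) (hllr : Integrable (llr μ ν) μ) :
    ∫ x, llr (posterior μ Φ) (posterior ν Φ) x ∂(posterior μ Φ) ≤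
      (∫ x, Real.exp (-Φ x) ∂μ)⁻¹ * ∫ x, llr μ ν x ∂μ := by
  have hμ := integrable_exp_neg_of_nonneg (μ := μ) hΦ hΦ0
  have hν := integrable_exp_neg_of_nonneg (μ := ν) hΦ hΦ0
  have hZμ := integral_exp_pos hμ
  have hZν := integral_exp_pos hν
  have := isProbabilityMeasure_posterior hμ
  rw [integral_congr_ae (llr_posterior hμν hΦ hμ hν),
    integral_add (Integrable.posterior hllr hΦ hΦ0) (integrable_const _), integral_const,
    probReal_univ, one_smul, integral_posterior hΦ hμ]
  have hgllr := Integrable.exp_neg_mul hllr hΦ hΦ0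
  have hkl := (InformationTheory.integrable_klFun_rnDeriv_iff hμν).mpr hllr
  have hle : ∫ x, Real.exp (-Φ x) * InformationTheory.klFun (μ.rnDeriv ν x).toReal ∂ν ≤
      ∫ x, llr μ ν x ∂μ := by
    calc _ ≤ ∫ x, InformationTheory.klFun (μ.rnDeriv ν x).toReal ∂ν :=
          integral_mono (Integrable.exp_neg_mul hkl hΦ hΦ0) hkl fun x =>
            mul_le_of_le_one_left (InformationTheory.klFun_nonneg ENNReal.toReal_nonneg)
              (Real.exp_le_one_iff.mpr (neg_nonpos.mpr (hΦ0 x)))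
      _ = _ := by simp [InformationTheory.integral_klFun_rnDeriv hμν hllr]
  have hexpand : ∫ x, Real.exp (-Φ x) * InformationTheory.klFun (μ.rnDeriv ν x).toReal ∂ν =
      ∫ x, Real.exp (-Φ x) * llr μ ν x ∂μ + ∫ x, Real.exp (-Φ x) ∂ν -
        ∫ x, Real.exp (-Φ x) ∂μ := by
    rw [← integral_rnDeriv_smul hμν (f := fun x => Real.exp (-Φ x)),
      ← integral_rnDeriv_smul hμν (f := fun x => Real.exp (-Φ x) * llr μ ν x),
      ← integral_add' ((integrable_rnDeriv_smul_iff hμν).mpr hgllr) hν,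
      ← integral_sub (((integrable_rnDeriv_smul_iff hμν).mpr hgllr).add hν)
        ((integrable_rnDeriv_smul_iff hμν).mpr hμ)]
    refine integral_congr_ae (.of_forall fun x => ?_)
    simp only [InformationTheory.klFun, llr, smul_eq_mul, Pi.add_apply]
    ring
  have hlog := Real.log_le_sub_one_of_pos (div_pos hZν hZμ)
  calc _ ≤ (∫ x, Real.exp (-Φ x) ∂μ)⁻¹ * ∫ x, Real.exp (-Φ x) * llr μ ν x ∂μ +
        ((∫ x, Real.exp (-Φ x) ∂ν) / (∫ x, Real.exp (-Φ x) ∂μ) - 1) := by gcongr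
    _ = (∫ x, Real.exp (-Φ x) ∂μ)⁻¹ *
        ∫ x, Real.exp (-Φ x) * InformationTheory.klFun (μ.rnDeriv ν x).toReal ∂ν := by
      rw [hexpand]
      field_simp
      ring
    _ ≤ _ := by gcongr

lemma klDiv_posterior_le [IsProbabilityMeasure μ] [IsProbabilityMeasure ν]
    (hμν : μ ≪ ν) (hΦ : Measurable Φ) (hΦ0 : ∀ x, 0 ≤ Φ x) :
    klDiv (posterior μ Φ) (posterior ν Φ) ≤
      ENNReal.ofReal (∫ x, Real.exp (-Φ x) ∂μ)⁻¹ * klDiv μ ν := by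
  have hμ := integrable_exp_neg_of_nonneg (μ := μ) hΦ hΦ0
  have hν := integrable_exp_neg_of_nonneg (μ := ν) hΦ hΦ0
  have hZμ := integral_exp_pos hμ
  by_cases hllr : Integrable (llr μ ν) μ
  · have := isProbabilityMeasure_posterior hμ
    have hpost : Integrable (llr (posterior μ Φ) (posterior ν Φ)) (posterior μ Φ) :=
      ((Integrable.posterior hllr hΦ hΦ0).add (integrable_const _)).congr
        (llr_posterior hμν hΦ hμ hν).symm
    rw [klDiv, klDiv, if_pos ⟨posterior_absolutelyContinuous_posterior hμν hΦ hμ hν, hpost⟩,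
      if_pos ⟨hμν, hllr⟩, ← ENNReal.ofReal_mul (by positivity)]
    exact ENNReal.ofReal_le_ofReal (integral_llr_posterior_le hμν hΦ hΦ0 hllr)
  · have htop : klDiv μ ν = ⊤ := if_neg fun h => hllr h.2
    rw [htop, ENNReal.mul_top (ENNReal.ofReal_pos.mpr (inv_pos.mpr hZμ)).ne']
    exact le_top

end Posterior

theorem kl_stability_prior
    {E : Type*} [MetricSpace E] [CompleteSpace E] [TopologicalSpace.SeparableSpace E]
    [MeasurableSpace E] [BorelSpace E]
    (μ μt : Measure E) [IsProbabilityMeasure μ] [IsProbabilityMeasure μt]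
    (hequiv : μ ≪ μt ∧ μt ≪ μ)
    (Φ : E → ℝ) (hΦmeas : Measurable Φ) (hΦpos : ∀ x, 0 ≤ Φ x) :
    klDiv (posterior μ Φ) (posterior μt Φ) ≤
      ENNReal.ofReal (1 / min (∫ x, Real.exp (-Φ x) ∂μ) (∫ x, Real.exp (-Φ x) ∂μt)) *
        (klDiv μ μt + klDiv μt μ) := by
  have hμ := integral_exp_pos (integrable_exp_neg_of_nonneg (μ := μ) hΦmeas hΦpos)
  have hμt := integral_exp_pos (integrable_exp_neg_of_nonneg (μ := μt) hΦmeas hΦpos)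
  refine (klDiv_posterior_le hequiv.1 hΦmeas hΦpos).trans (mul_le_mul' ?_ le_self_add)
  rw [← one_div]
  exact ENNReal.ofReal_le_ofReal
    (one_div_le_one_div_of_le (lt_min hμ hμt) (min_le_left _ _))
end

section
/- Let (E, d_E) be bounded with sup_{x,y ∈ E} d_E(x, y) ≤ D < ∞, let Φ : E → [0, ∞) be measurable such that exp(−Φ) : E → [0, 1] is Lipschitz with constant Lip(exp(−Φ)) < ∞ with respect to d_E, and let μ, μ̃ ∈ P(E). Then the posterior measures μ_Φ(dx) := Z^{−1} exp(−Φ(x)) μ(dx) and μ̃_Φ(dx) := Z̃^{−1} exp(−Φ(x)) μ̃(dx), with Z := ∫_E exp(−Φ) dμ and Z̃ := ∫_E exp(−Φ) dμ̃, satisfy W₁(μ_Φ, μ̃_Φ) ≤ ((1 + D·Lip(exp(−Φ)))² / min(Z, Z̃)²) · W₁(μ, μ̃). -/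
open MeasureTheory ENNReal

/-- The 1-Wasserstein distance: infimum of `∫ d(x,y) dπ` over all couplings `π` of `μ` and `ν`. -/
noncomputable def wasserstein1 {E : Type*} [EDist E] [MeasurableSpace E]
    (μ ν : Measure E) : ℝ≥0∞ :=
  ⨅ (π : Measure (E × E)) (_ : π.map Prod.fst = μ) (_ : π.map Prod.snd = ν),
    ∫⁻ p, edist p.1 p.2 ∂π

/-- `|μ|_{P^q} = inf_{x₀} (∫ d(x,x₀)^q dμ)^{1/q}`. -/
noncomputable def ePnorm {E : Type*} [EDist E] [MeasurableSpace E] (q : ℝ) (μ : Measure E) :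
    ℝ≥0∞ :=
  ⨅ x₀ : E, (∫⁻ x, edist x x₀ ^ q ∂μ) ^ (1 / q)

/-- Two finite measures of equal mass on a space of diameter at most `D` have a coupling of cost at
most `D` times their mass. -/
lemma exists_coupling_lintegral_edist_le {E : Type*} [EDist E] [MeasurableSpace E]
    {D : ℝ≥0∞} (hD : ∀ x y : E, edist x y ≤ D) (ρ σ : Measure E) [IsFiniteMeasure ρ]
    [IsFiniteMeasure σ] (h : ρ Set.univ = σ Set.univ) :
    ∃ κ : Measure (E × E), κ.map Prod.fst = ρ ∧ κ.map Prod.snd = σ ∧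
      ∫⁻ p, edist p.1 p.2 ∂κ ≤ D * ρ Set.univ := by
  rcases eq_or_ne (ρ Set.univ) 0 with h0 | h0
  · have hσ : σ = 0 := Measure.measure_univ_eq_zero.1 (h ▸ h0)
    have hρ : ρ = 0 := Measure.measure_univ_eq_zero.1 h0
    exact ⟨0, by simp [hρ], by simp [hσ], by simp⟩
  · have ht : ρ Set.univ ≠ ∞ := measure_ne_top ρ _
    refine ⟨(ρ Set.univ)⁻¹ • ρ.prod σ, ?_, ?_, ?_⟩
    · rw [Measure.map_smul, Measure.map_fst_prod, ← h, smul_smul,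
        ENNReal.inv_mul_cancel h0 ht, one_smul]
    · rw [Measure.map_smul, Measure.map_snd_prod, smul_smul,
        ENNReal.inv_mul_cancel h0 ht, one_smul]
    · refine (lintegral_mono fun p : E × E => hD p.1 p.2).trans_eq ?_
      rw [lintegral_const, Measure.smul_apply, ← Set.univ_prod_univ, Measure.prod_prod, ← h,
        smul_eq_mul, ← mul_assoc (ρ Set.univ)⁻¹, ENNReal.inv_mul_cancel h0 ht, one_mul]

lemma withDensity_map {α β : Type*} [MeasurableSpace α] [MeasurableSpace β] (π : Measure α)
    {φ : α → β} (hφ : Measurable φ) {g : β → ℝ≥0∞} (hg : Measurable g) :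
    (π.map φ).withDensity g = (π.withDensity (g ∘ φ)).map φ := by
  ext s hs
  rw [withDensity_apply _ hs, Measure.map_apply hφ hs, withDensity_apply _ (hφ hs),
    setLIntegral_map hs hg hφ]
  rfl

/-- Reweighting the two marginals of a plan by densities `a` and `b` of equal mass costs at most
the common part `min a b` transported along the plan, plus `D` times the excess mass. -/
lemma wasserstein1_map_withDensity_le {E : Type*} [EDist E] [MeasurableSpace E]
    {D : ℝ≥0∞} (hD : ∀ x y : E, edist x y ≤ D) (π : Measure (E × E)) {a b : E × E → ℝ≥0∞}
    (ha : Measurable a) (hb : Measurable b) (hab : ∫⁻ p, a p ∂π = ∫⁻ p, b p ∂π)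
    (hfin : ∫⁻ p, a p ∂π ≠ ∞) :
    wasserstein1 ((π.withDensity a).map Prod.fst) ((π.withDensity b).map Prod.snd) ≤
        ∫⁻ p, edist p.1 p.2 ∂(π.withDensity fun p => min (a p) (b p)) +
          D * ∫⁻ p, (a p - b p) ∂π ∧
      ∫⁻ p, (a p - b p) ∂π = ∫⁻ p, (b p - a p) ∂π := by
  have hmin : Measurable fun p => min (a p) (b p) := ha.min hb
  have hsplit : ∀ {u v : E × E → ℝ≥0∞},
      (fun p => min (u p) (v p)) + (fun p => u p - v p) = u := by
    intro u v
    funext p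
    exact (add_comm _ _).trans tsub_add_min
  have hsplit' : (fun p => min (a p) (b p)) + (fun p => b p - a p) = b := by
    simpa only [min_comm] using hsplit (u := b) (v := a)
  have hI : ∫⁻ p, min (a p) (b p) ∂π ≠ ∞ :=
    ((lintegral_mono fun p => min_le_left _ _).trans_lt hfin.lt_top).ne
  have hmass : ∫⁻ p, (a p - b p) ∂π = ∫⁻ p, (b p - a p) ∂π := by
    refine (ENNReal.add_right_inj hI).1 ?_
    rw [← lintegral_add_left hmin, ← lintegral_add_left hmin]
    exact Eq.trans (congrArg (fun u => ∫⁻ p, u p ∂π) hsplit)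
      (hab.trans (congrArg (fun u => ∫⁻ p, u p ∂π) hsplit').symm)
  refine ⟨?_, hmass⟩
  have hle : ∫⁻ p, (a p - b p) ∂π ≠ ∞ :=
    ((lintegral_mono fun p => tsub_le_self).trans_lt hfin.lt_top).ne
  have := isFiniteMeasure_withDensity hle
  have := isFiniteMeasure_withDensity (hmass ▸ hle)
  have hρ : ((π.withDensity fun p => a p - b p).map Prod.fst) Set.univ =
      ∫⁻ p, (a p - b p) ∂π := by
    simp [Measure.map_apply measurable_fst]
  obtain ⟨κ, h₁, h₂, hκ⟩ := exists_coupling_lintegral_edist_le hD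
    ((π.withDensity fun p => a p - b p).map Prod.fst)
    ((π.withDensity fun p => b p - a p).map Prod.snd)
    (by rw [hρ, hmass]; simp [Measure.map_apply measurable_snd])
  rw [hρ] at hκ
  refine (iInf_le_of_le ((π.withDensity fun p => min (a p) (b p)) + κ) <|
    iInf₂_le_of_le ?_ ?_ le_rfl).trans ?_
  · rw [Measure.map_add _ _ measurable_fst, h₁, ← Measure.map_add _ _ measurable_fst,
      ← withDensity_add_left hmin, hsplit]
  · rw [Measure.map_add _ _ measurable_snd, h₂, ← Measure.map_add _ _ measurable_snd,
      ← withDensity_add_left hmin, hsplit']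
  · rw [lintegral_add_measure]
    gcongr

/-- Transport cost between reweighted marginals of a plan, for an `L`-Lipschitz weight `f ≤ 1`. -/
lemma wasserstein1_smul_withDensity_le {E : Type*} [PseudoEMetricSpace E]
    [SecondCountableTopology E] [MeasurableSpace E] [BorelSpace E]
    {D L : ℝ≥0∞} (hD : ∀ x y : E, edist x y ≤ D) {f : E → ℝ≥0∞} (hf : Measurable f)
    (hf1 : ∀ x, f x ≤ 1) (hfL : ∀ x y, f x - f y ≤ L * edist x y) (π : Measure (E × E))
    {Z Zt : ℝ≥0∞} (hZ : ∫⁻ x, f x ∂(π.map Prod.fst) = Z) (hZt : ∫⁻ x, f x ∂(π.map Prod.snd) = Zt)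
    (hZ0 : Z ≠ 0) (hZt0 : Zt ≠ 0) (hZtop : Z ≠ ∞) (hZttop : Zt ≠ ∞) :
    wasserstein1 (Z⁻¹ • (π.map Prod.fst).withDensity f)
        (Zt⁻¹ • (π.map Prod.snd).withDensity f) ≤
      (max Z Zt)⁻¹ * (1 + D * L) * ∫⁻ p, edist p.1 p.2 ∂π := by
  have hd : Measurable fun p : E × E => edist p.1 p.2 := measurable_edist
  have hf₁ : Measurable fun p : E × E => f p.1 := hf.comp measurable_fst
  have hf₂ : Measurable fun p : E × E => f p.2 := hf.comp measurable_snd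
  rw [lintegral_map hf measurable_fst] at hZ
  rw [lintegral_map hf measurable_snd] at hZt
  have hia : ∫⁻ p, Z⁻¹ * f p.1 ∂π = 1 := by
    rw [lintegral_const_mul _ hf₁, hZ, ENNReal.inv_mul_cancel hZ0 hZtop]
  have hib : ∫⁻ p, Zt⁻¹ * f p.2 ∂π = 1 := by
    rw [lintegral_const_mul _ hf₂, hZt, ENNReal.inv_mul_cancel hZt0 hZttop]
  obtain ⟨hW, hmass⟩ := wasserstein1_map_withDensity_le hD π (hf₁.const_mul Z⁻¹)
    (hf₂.const_mul Zt⁻¹) (hia.trans hib.symm) (by simp [hia])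
  have hm₁ : (π.withDensity fun p => Z⁻¹ * f p.1).map Prod.fst =
      Z⁻¹ • (π.map Prod.fst).withDensity f := by
    rw [← withDensity_smul _ hf, withDensity_map π measurable_fst (hf.const_smul _)]
    rfl
  have hm₂ : (π.withDensity fun p => Zt⁻¹ * f p.2).map Prod.snd =
      Zt⁻¹ • (π.map Prod.snd).withDensity f := by
    rw [← withDensity_smul _ hf, withDensity_map π measurable_snd (hf.const_smul _)]
    rfl
  rw [hm₁, hm₂] at hW
  have hexcess : ∫⁻ p, (Z⁻¹ * f p.1 - Zt⁻¹ * f p.2) ∂π ≤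
      (max Z Zt)⁻¹ * L * ∫⁻ p, edist p.1 p.2 ∂π := by
    rcases le_total Zt Z with h | h
    · rw [max_eq_left h, ← lintegral_const_mul _ hd]
      refine lintegral_mono fun p => ?_
      calc Z⁻¹ * f p.1 - Zt⁻¹ * f p.2 ≤ Z⁻¹ * f p.1 - Z⁻¹ * f p.2 := by gcongr
        _ = Z⁻¹ * (f p.1 - f p.2) := (ENNReal.mul_sub fun _ _ => by simpa using hZ0).symm
        _ ≤ Z⁻¹ * L * edist p.1 p.2 := by
          rw [mul_assoc]
          gcongr
          exact hfL _ _
    · rw [hmass, max_eq_right h, ← lintegral_const_mul _ hd]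
      refine lintegral_mono fun p => ?_
      calc Zt⁻¹ * f p.2 - Z⁻¹ * f p.1 ≤ Zt⁻¹ * f p.2 - Zt⁻¹ * f p.1 := by gcongr
        _ = Zt⁻¹ * (f p.2 - f p.1) := (ENNReal.mul_sub fun _ _ => by simpa using hZt0).symm
        _ ≤ Zt⁻¹ * L * edist p.1 p.2 := by
          rw [mul_assoc, edist_comm]
          gcongr
          exact hfL _ _
  have hcommon : ∫⁻ p, edist p.1 p.2 ∂(π.withDensity fun p => min (Z⁻¹ * f p.1) (Zt⁻¹ * f p.2)) ≤
      (max Z Zt)⁻¹ * ∫⁻ p, edist p.1 p.2 ∂π := by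
    rw [lintegral_withDensity_eq_lintegral_mul _ ((hf₁.const_mul _).min (hf₂.const_mul _)) hd,
      ← lintegral_const_mul _ hd]
    refine lintegral_mono fun p => ?_
    refine mul_le_mul_left ?_ _
    rcases le_total Zt Z with h | h
    · rw [max_eq_left h]
      exact (min_le_left _ _).trans (mul_le_of_le_one_right' (hf1 _))
    · rw [max_eq_right h]
      exact (min_le_right _ _).trans (mul_le_of_le_one_right' (hf1 _))
  calc _ ≤ _ := hW
    _ ≤ (max Z Zt)⁻¹ * ∫⁻ p, edist p.1 p.2 ∂π +
        D * ((max Z Zt)⁻¹ * L * ∫⁻ p, edist p.1 p.2 ∂π) := by gcongr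
    _ = _ := by ring

theorem wasserstein_stability_prior_simple
    {E : Type*} [MetricSpace E] [CompleteSpace E] [TopologicalSpace.SeparableSpace E]
    [MeasurableSpace E] [BorelSpace E]
    (D : ℝ) (hD : ∀ x y : E, dist x y ≤ D)
    (Φ : E → ℝ) (hΦmeas : Measurable Φ) (hΦpos : ∀ x, 0 ≤ Φ x)
    (L : NNReal) (hLip : LipschitzWith L (fun x => Real.exp (-Φ x)))
    (μ μt : Measure E) [IsProbabilityMeasure μ] [IsProbabilityMeasure μt] :
    wasserstein1 (posterior μ Φ) (posterior μt Φ) ≤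
      ENNReal.ofReal ((1 + D * L) ^ 2 /
          min (∫ x, Real.exp (-Φ x) ∂μ) (∫ x, Real.exp (-Φ x) ∂μt) ^ 2) *
        wasserstein1 μ μt := by
  have hcont : Continuous fun x => Real.exp (-Φ x) := hLip.continuous
  have hle : ∀ x, Real.exp (-Φ x) ≤ 1 := fun x => Real.exp_le_one_iff.2 (by simpa using hΦpos x)
  have hint : ∀ ν : Measure E, IsProbabilityMeasure ν → Integrable (fun x => Real.exp (-Φ x)) ν :=
    fun ν _ => Integrable.of_bound hcont.measurable.aestronglyMeasurable 1
      (.of_forall fun x => by simpa [abs_of_pos (Real.exp_pos _)] using hle x)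
  have hpos : ∀ ν : Measure E, IsProbabilityMeasure ν → 0 < ∫ x, Real.exp (-Φ x) ∂ν :=
    fun ν _ => integral_exp_pos (hint ν inferInstance)
  have hone : ∀ ν : Measure E, IsProbabilityMeasure ν → ∫ x, Real.exp (-Φ x) ∂ν ≤ 1 := by
    intro ν _
    simpa using integral_mono (hint ν inferInstance) (integrable_const (1 : ℝ)) hle
  have hZ : ∀ ν : Measure E, IsProbabilityMeasure ν →
      ∫⁻ x, ENNReal.ofReal (Real.exp (-Φ x)) ∂ν = ENNReal.ofReal (∫ x, Real.exp (-Φ x) ∂ν) :=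
    fun ν h => (ofReal_integral_eq_lintegral_ofReal (hint ν h)
      (.of_forall fun x => (Real.exp_pos _).le)).symm
  have hfL : ∀ x y, ENNReal.ofReal (Real.exp (-Φ x)) - ENNReal.ofReal (Real.exp (-Φ y)) ≤
      L * edist x y := by
    intro x y
    rw [← ENNReal.ofReal_sub _ (Real.exp_pos _).le]
    refine (ENNReal.ofReal_le_ofReal (le_abs_self _)).trans ?_
    rw [← Real.dist_eq, ← edist_dist]
    exact hLip x y
  have hED : ∀ x y : E, edist x y ≤ ENNReal.ofReal D := fun x y => by
    rw [edist_dist]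
    exact ENNReal.ofReal_le_ofReal (hD x y)
  have := UniformSpace.secondCountable_of_separable E
  obtain ⟨x₀⟩ := nonempty_of_isProbabilityMeasure μ
  have hD0 : 0 ≤ D := dist_nonneg.trans (hD x₀ x₀)
  have hZμ := hZ μ inferInstance
  have hZμt := hZ μt inferInstance
  have hposμ := hpos μ inferInstance
  have hposμt := hpos μt inferInstance
  have honeμ := hone μ inferInstance
  set Z := ∫ x, Real.exp (-Φ x) ∂μ
  set Zt := ∫ x, Real.exp (-Φ x) ∂μt
  have hm : 0 < min Z Zt := lt_min hposμ hposμt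
  have hDL : 0 ≤ D * L := mul_nonneg hD0 L.2
  have hC : 0 < (1 + D * L) ^ 2 / min Z Zt ^ 2 := by positivity
  have hconst : (max (ENNReal.ofReal Z) (ENNReal.ofReal Zt))⁻¹ * (1 + ENNReal.ofReal D * L) ≤
      ENNReal.ofReal ((1 + D * L) ^ 2 / min Z Zt ^ 2) := by
    have hrw : (max (ENNReal.ofReal Z) (ENNReal.ofReal Zt))⁻¹ * (1 + ENNReal.ofReal D * L) =
        ENNReal.ofReal ((max Z Zt)⁻¹ * (1 + D * L)) := by
      rw [ENNReal.ofReal_mul (by positivity), ENNReal.ofReal_inv_of_pos (by positivity),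
        ENNReal.ofReal_add zero_le_one hDL, ENNReal.ofReal_mul hD0, ENNReal.ofReal_one,
        ENNReal.ofReal_coe_nnreal, ENNReal.ofReal_max]
    rw [hrw, inv_mul_eq_div]
    refine ENNReal.ofReal_le_ofReal ?_
    have hmax : min Z Zt ^ 2 ≤ max Z Zt :=
      (pow_le_of_le_one hm.le ((min_le_left _ _).trans honeμ) two_ne_zero).trans min_le_max
    gcongr
    exact le_self_pow₀ (by linarith) two_ne_zero
  have hC0 : ENNReal.ofReal ((1 + D * L) ^ 2 / min Z Zt ^ 2) ≠ 0 := by simpa using hC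
  rw [wasserstein1.eq_def μ μt]
  simp only [ENNReal.mul_iInf_of_ne hC0 ENNReal.ofReal_ne_top]
  refine le_iInf fun π => le_iInf₂ fun h₁ h₂ => ?_
  refine le_trans ?_ (mul_le_mul_left hconst _)
  have key := wasserstein1_smul_withDensity_le hED
    hcont.measurable.ennreal_ofReal (fun x => ENNReal.ofReal_le_one.2 (hle x)) hfL π
    (by rw [h₁]; exact hZμ) (by rw [h₂]; exact hZμt) (by simpa using hposμ)
    (by simpa using hposμt) ENNReal.ofReal_ne_top ENNReal.ofReal_ne_top
  rw [h₁, h₂] at key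
  unfold posterior
  rw [hZμ, hZμt]
  exact key
end
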